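/- arXiv:2006.12438 — 4 statements merged into one kernel-verified Lean document; each statement's English description precedes it below -/
import Mathlib

section
/- For every fixed k ≥ 1, the arithmetic function n ↦ φ_k(n) is multiplicative: φ_k(1) = 1 and φ_k(mn) = φ_k(m)·φ_k(n) whenever gcd(m, n) = 1. -/
/-- The k-dimensional generalized Euler function: the number of k-tuples
`(a_1, …, a_k)` with `1 ≤ a_i ≤ n`, `gcd(a_1⋯a_k, n) = 1` and `gcd(a_1+⋯+a_k, n) = 1`. -/
def phiK (k n : ℕ) : ℕ :=
  ((Fintype.piFinset fun _ : Fin k => Finset.Icc 1 n).filter fun a =>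
    Nat.gcd (∏ i, a i) n = 1 ∧ Nat.gcd (∑ i, a i) n = 1).card

/-- The `k`-tuples in a commutative ring whose product and sum are both units. -/
def unitTuples (k : ℕ) (R : Type*) [CommRing R] : Set (Fin k → R) :=
  {a | IsUnit (∏ i, a i) ∧ IsUnit (∑ i, a i)}

theorem ncard_unitTuples_congr (k : ℕ) {R S : Type*} [CommRing R] [CommRing S] (e : R ≃+* S) :
    (unitTuples k R).ncard = (unitTuples k S).ncard := by
  refine Nat.card_congr ((Equiv.arrowCongr (Equiv.refl (Fin k)) e.toEquiv).subtypeEquiv fun a => ?_)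
  change IsUnit (∏ i, a i) ∧ IsUnit (∑ i, a i) ↔ IsUnit (∏ i, e (a i)) ∧ IsUnit (∑ i, e (a i))
  simp only [← map_prod, ← map_sum, MulEquiv.isUnit_map]

theorem ncard_unitTuples_prod (k : ℕ) (R S : Type*) [CommRing R] [CommRing S] :
    (unitTuples k (R × S)).ncard = (unitTuples k R).ncard * (unitTuples k S).ncard := by
  rw [← Set.ncard_prod]
  refine Nat.card_congr ((Equiv.arrowProdEquivProdArrow (Fin k) (fun _ => R)
    fun _ => S).subtypeEquiv fun a => ?_)
  change IsUnit (∏ i, a i) ∧ IsUnit (∑ i, a i) ↔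
    (IsUnit (∏ i, (a i).1) ∧ IsUnit (∑ i, (a i).1)) ∧
      (IsUnit (∏ i, (a i).2) ∧ IsUnit (∑ i, (a i).2))
  simp only [Prod.isUnit_iff, Prod.fst_prod, Prod.snd_prod, Prod.fst_sum, Prod.snd_sum]
  tauto

theorem ZMod.bijOn_natCast_Icc (n : ℕ) [NeZero n] :
    Set.BijOn (fun a : ℕ => (a : ZMod n)) (Set.Icc 1 n) Set.univ := by
  refine ⟨fun _ _ => Set.mem_univ _, fun a ha b hb h => ?_, fun x _ => ?_⟩
  · obtain ⟨ha1, ha2⟩ := ha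
    obtain ⟨hb1, hb2⟩ := hb
    have h' : ((a : ℤ) : ZMod n) = ((b : ℤ) : ZMod n) := by simpa using h
    rw [ZMod.intCast_eq_intCast_iff_dvd_sub] at h'
    have := Int.eq_zero_of_abs_lt_dvd h' (by rw [abs_lt]; omega)
    omega
  · by_cases hx : x = 0
    · exact ⟨n, ⟨NeZero.one_le, le_rfl⟩, by simp [hx]⟩
    · exact ⟨x.val, ⟨Nat.one_le_iff_ne_zero.2 ((ZMod.val_ne_zero x).2 hx), x.val_lt.le⟩,
        ZMod.natCast_zmod_val x⟩

theorem phiK_eq_ncard_unitTuples (k n : ℕ) [NeZero n] :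
    phiK k n = (unitTuples k (ZMod n)).ncard := by
  have hbij := ZMod.bijOn_natCast_Icc n
  have hiff (a : Fin k → ℕ) : (fun i => (a i : ZMod n)) ∈ unitTuples k (ZMod n) ↔
      Nat.gcd (∏ i, a i) n = 1 ∧ Nat.gcd (∑ i, a i) n = 1 := by
    change IsUnit (∏ i, (a i : ZMod n)) ∧ IsUnit (∑ i, (a i : ZMod n)) ↔ _
    rw [← Nat.cast_prod, ← Nat.cast_sum, ZMod.isUnit_iff_coprime, ZMod.isUnit_iff_coprime]
  rw [phiK, ← Set.ncard_coe_finset]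
  refine Set.ncard_congr (fun a _ i => (a i : ZMod n)) (fun a ha => ?_) (fun a b ha hb h => ?_)
    fun x hx => ?_
  · exact (hiff a).2 (Finset.mem_filter.1 ha).2
  · have ha' := Fintype.mem_piFinset.1 (Finset.mem_filter.1 ha).1
    have hb' := Fintype.mem_piFinset.1 (Finset.mem_filter.1 hb).1
    exact funext fun i => hbij.injOn (Finset.mem_Icc.1 (ha' i)) (Finset.mem_Icc.1 (hb' i))
      (congrFun h i)
  · choose a ha hax using fun i => hbij.surjOn (Set.mem_univ (x i))
    obtain rfl : (fun i => (a i : ZMod n)) = x := funext hax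
    exact ⟨a, Finset.mem_filter.2
      ⟨Fintype.mem_piFinset.2 fun i => Finset.mem_Icc.2 (ha i), (hiff a).1 hx⟩, rfl⟩

theorem phiK_zero_right {k : ℕ} (hk : 1 ≤ k) : phiK k 0 = 0 := by
  have : NeZero k := ⟨by omega⟩
  simp [phiK]

theorem phiK_one_right (k : ℕ) : phiK k 1 = 1 := by
  simp [phiK]

theorem phiK_multiplicative (k : ℕ) (hk : 1 ≤ k) :
    phiK k 1 = 1 ∧
      ∀ m n : ℕ, Nat.gcd m n = 1 → phiK k (m * n) = phiK k m * phiK k n := by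
  refine ⟨phiK_one_right k, fun m n h => ?_⟩
  rcases Nat.eq_zero_or_pos m with rfl | hm
  · simp [phiK_zero_right hk]
  rcases Nat.eq_zero_or_pos n with rfl | hn
  · simp [phiK_zero_right hk]
  have : NeZero m := ⟨hm.ne'⟩
  have : NeZero n := ⟨hn.ne'⟩
  rw [phiK_eq_ncard_unitTuples, phiK_eq_ncard_unitTuples, phiK_eq_ncard_unitTuples,
    ncard_unitTuples_congr k (ZMod.chineseRemainder h), ncard_unitTuples_prod]
end

section
/- For k, n ∈ ℕ with k ≥ 1 and n ≥ 1, φ_k(n) = 0 if and only if both k and n are even. -/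
theorem phiK_eq_zero_of_even {k n : ℕ} (hk : Even k) (hn : Even n) : phiK k n = 0 := by
  rw [phiK, Finset.card_eq_zero, Finset.filter_eq_empty_iff]
  rintro a - ⟨hprod, hsum⟩
  have hodd : ∀ i, Odd (a i) := fun i =>
    Nat.coprime_two_right.mp <| Nat.Coprime.of_dvd
      (Finset.dvd_prod_of_mem a (Finset.mem_univ i)) hn.two_dvd hprod
  have hsum_odd : Odd (∑ i, a i) :=
    Nat.coprime_two_right.mp <| Nat.Coprime.of_dvd_right hn.two_dvd hsum
  rw [Finset.odd_sum_iff_odd_card_odd, Finset.filter_true_of_mem fun i _ => hodd i,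
    Finset.card_univ, Fintype.card_fin] at hsum_odd
  exact Nat.not_even_iff_odd.mpr hsum_odd hk

/-- The tuple consisting of `m` entries `n - 1` and `m + r` entries `1` has sum `m * n + r`. -/
theorem phiK_ne_zero_of_coprime {m r n : ℕ} (hn : 2 ≤ n) (hr : Nat.Coprime r n) :
    phiK (m + (m + r)) n ≠ 0 := by
  rw [phiK, Finset.card_ne_zero]
  refine ⟨Fin.append (fun _ : Fin m => n - 1) (fun _ : Fin (m + r) => 1),
    Finset.mem_filter.mpr ⟨?_, ?_, ?_⟩⟩
  · rw [Fintype.mem_piFinset]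
    intro i
    refine Fin.addCases (fun j => ?_) (fun j => ?_) i <;> simp <;> omega
  · have h : Nat.Coprime (n - 1) n := by
      rw [Nat.coprime_self_sub_left (by omega)]
      exact Nat.coprime_one_left n
    simpa [Fin.prod_univ_add] using h.pow_left m
  · obtain ⟨t, rfl⟩ : ∃ t, n = t + 1 := ⟨n - 1, by omega⟩
    have h : m * t + (m + r) = r + m * (t + 1) := by ring
    simpa [Fin.sum_univ_add, h] using hr

theorem phiK_one_ne_zero (k : ℕ) : phiK k 1 ≠ 0 := by
  rw [phiK, Finset.card_ne_zero]
  exact ⟨fun _ => 1, by simp⟩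

theorem phiK_eq_zero_iff (k n : ℕ) (hk : 1 ≤ k) (hn : 1 ≤ n) :
    phiK k n = 0 ↔ Even k ∧ Even n := by
  refine ⟨fun h => ?_, fun h => phiK_eq_zero_of_even h.1 h.2⟩
  obtain rfl | hn2 : n = 1 ∨ 2 ≤ n := by omega
  · exact absurd h (phiK_one_ne_zero k)
  have hk_even : Even k := by
    by_contra hk'
    obtain ⟨m, rfl⟩ := Nat.not_even_iff_odd.mp hk'
    rw [show 2 * m + 1 = m + (m + 1) by ring] at h
    exact phiK_ne_zero_of_coprime hn2 (Nat.coprime_one_left n) h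
  refine ⟨hk_even, ?_⟩
  by_contra hn'
  obtain ⟨m, rfl⟩ := hk_even
  obtain ⟨l, rfl⟩ : ∃ l, m = l + 1 := ⟨m - 1, by omega⟩
  rw [show l + 1 + (l + 1) = l + (l + 2) by ring] at h
  exact phiK_ne_zero_of_coprime hn2
    (Nat.coprime_two_left.mpr (Nat.not_even_iff_odd.mp hn')) h
end

section
/- Let n, d, e ∈ ℕ with d | n and e | n, and let r, s ∈ ℤ. Then the number of integers a with 1 ≤ a ≤ n, gcd(a, n) = 1, a ≡ r (mod d) and a ≡ s (mod e) equals φ(n)·gcd(d, e)/φ(d·e) if gcd(r, d) = gcd(s, e) = 1 and gcd(d, e) | r - s, and equals 0 otherwise. -/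
theorem totient_mul_eq_gcd_mul_totient_lcm {d e : ℕ} (hd : 0 < d) :
    Nat.totient (d * e) = Nat.gcd d e * Nat.totient (Nat.lcm d e) := by
  have h := Nat.totient_gcd_mul_totient_mul (Nat.gcd d e) (Nat.lcm d e)
  rw [Nat.gcd_eq_left ((Nat.gcd_dvd_left d e).trans (Nat.dvd_lcm_left d e)),
    Nat.gcd_mul_lcm] at h
  have hg : 0 < Nat.totient (Nat.gcd d e) :=
    Nat.totient_pos.2 (Nat.gcd_pos_of_pos_left e hd)
  refine Nat.eq_of_mul_eq_mul_left hg ?_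
  rw [h]
  ring

theorem exists_modEq_modEq_of_gcd_dvd_sub {d e : ℕ} {r s : ℤ}
    (h : (Nat.gcd d e : ℤ) ∣ r - s) : ∃ t : ℤ, t ≡ r [ZMOD d] ∧ t ≡ s [ZMOD e] := by
  obtain ⟨k, hk⟩ := h
  rw [Nat.gcd_eq_gcd_ab] at hk
  refine ⟨r - d * (Nat.gcdA d e * k), ?_, ?_⟩
  · exact (Int.modEq_iff_dvd.2 ⟨Nat.gcdA d e * k, by ring⟩)
  · exact (Int.modEq_iff_dvd.2 ⟨-(Nat.gcdB d e * k), by linear_combination -hk⟩)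

theorem gcd_eq_gcd_of_modEq {a b m : ℤ} (h : a ≡ b [ZMOD m]) : Int.gcd a m = Int.gcd b m := by
  rw [← Int.gcd_emod, h, Int.gcd_emod]

theorem gcd_eq_one_of_modEq {a n d : ℕ} {r : ℤ} (hd : d ∣ n) (ha : Nat.gcd a n = 1)
    (h : (a : ℤ) ≡ r [ZMOD d]) : Int.gcd r d = 1 := by
  rw [← gcd_eq_gcd_of_modEq h, Int.gcd_natCast_natCast]
  exact Nat.Coprime.coprime_dvd_right hd ha

theorem card_fiber_unitsMap_mul_totient {m n : ℕ} [NeZero n] [NeZero m] (hm : m ∣ n)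
    (u : (ZMod m)ˣ) :
    (Finset.univ.filter fun v : (ZMod n)ˣ => ZMod.unitsMap hm v = u).card * Nat.totient m =
      Nat.totient n := by
  have hfib := Finset.card_eq_sum_card_fiberwise (f := ZMod.unitsMap hm)
    (s := Finset.univ) (t := Finset.univ) (fun _ _ => Finset.mem_coe.2 (Finset.mem_univ _))
  rw [← ZMod.card_units_eq_totient n, ← ZMod.card_units_eq_totient m, ← Finset.card_univ,
    ← Finset.card_univ, hfib, mul_comm]
  refine (Finset.sum_const_nat fun w _ => ?_).symm
  exact MonoidHom.card_fiber_eq_of_mem_range _ (ZMod.unitsMap_surjective hm w)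
    (ZMod.unitsMap_surjective hm u)

theorem card_coprime_modEq_mul_totient {m n : ℕ} (hn : 1 ≤ n) (hm : m ∣ n) {t : ℤ}
    (ht : Int.gcd t m = 1) :
    ((Finset.Icc 1 n).filter fun a => Nat.gcd a n = 1 ∧ (a : ℤ) ≡ t [ZMOD m]).card *
      Nat.totient m = Nat.totient n := by
  have : NeZero n := ⟨by omega⟩
  have : NeZero m := ⟨by rintro rfl; exact absurd (Nat.eq_zero_of_zero_dvd hm) (by omega)⟩
  have htu : IsUnit (t : ZMod m) := by
    rw [ZMod.coe_int_isUnit_iff_isCoprime]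
    exact (Int.isCoprime_iff_gcd_eq_one.2 ht).symm
  obtain ⟨u, hu⟩ := htu
  rw [← card_fiber_unitsMap_mul_totient hm u]
  congr 1
  have key (a : ℕ) (v : (ZMod n)ˣ) (hv : (v : ZMod n) = a) :
      ZMod.unitsMap hm v = u ↔ (a : ℤ) ≡ t [ZMOD m] := by
    rw [← ZMod.intCast_eq_intCast_iff, ← hu, Units.ext_iff, ZMod.unitsMap_val, hv,
      ZMod.cast_natCast hm, Int.cast_natCast]
  refine Finset.card_bij (fun a ha => ZMod.unitOfCoprime a (Finset.mem_filter.1 ha).2.1)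
    (fun a ha => ?_) (fun a ha b hb hab => ?_) (fun v hv => ?_)
  · simpa [key a _ (ZMod.coe_unitOfCoprime a _)] using (Finset.mem_filter.1 ha).2.2
  · have h := congrArg Units.val hab
    rw [ZMod.coe_unitOfCoprime, ZMod.coe_unitOfCoprime, ZMod.natCast_eq_natCast_iff] at h
    have ha := Finset.mem_Icc.1 (Finset.mem_filter.1 ha).1
    have hb := Finset.mem_Icc.1 (Finset.mem_filter.1 hb).1
    have h' : a - 1 ≡ b - 1 [MOD n] := by
      refine Nat.ModEq.add_right_cancel' 1 ?_
      rwa [Nat.sub_add_cancel ha.1, Nat.sub_add_cancel hb.1]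
    have := h'.eq_of_lt_of_lt (by omega) (by omega)
    omega
  · obtain ⟨a, ha, hav⟩ : ∃ a ∈ Finset.Icc 1 n, (v : ZMod n) = a := by
      rcases Nat.eq_zero_or_pos (v : ZMod n).val with h | h
      · exact ⟨n, Finset.mem_Icc.2 ⟨hn, le_rfl⟩, by simpa using (ZMod.val_eq_zero _).1 h⟩
      · exact ⟨_, Finset.mem_Icc.2 ⟨h, (ZMod.val_lt _).le⟩, by simp⟩
    have hc : Nat.Coprime a n := (ZMod.isUnit_iff_coprime a n).1 (hav ▸ v.isUnit)
    exact ⟨a, Finset.mem_filter.2 ⟨ha, hc, (key a v hav).1 (Finset.mem_filter.1 hv).2⟩,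
      Units.ext (by rw [ZMod.coe_unitOfCoprime, hav])⟩

theorem count_coprime_two_congruences (n d e : ℕ) (hn : 1 ≤ n) (hd : d ∣ n) (he : e ∣ n)
    (r s : ℤ) :
    ((((Finset.Icc 1 n).filter fun a =>
        Nat.gcd a n = 1 ∧ (a : ℤ) ≡ r [ZMOD (d : ℤ)] ∧ (a : ℤ) ≡ s [ZMOD (e : ℤ)]).card : ℝ)) =
      if Int.gcd r d = 1 ∧ Int.gcd s e = 1 ∧ ((Nat.gcd d e : ℤ) ∣ r - s) then
        (Nat.totient n : ℝ) * (Nat.gcd d e : ℝ) / (Nat.totient (d * e) : ℝ)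
      else 0 := by
  have hd0 : 0 < d := Nat.pos_of_dvd_of_pos hd hn
  have he0 : 0 < e := Nat.pos_of_dvd_of_pos he hn
  split_ifs with h
  · obtain ⟨hr, hs, hrs⟩ := h
    obtain ⟨t, htr, hts⟩ := exists_modEq_modEq_of_gcd_dvd_sub hrs
    have htd : IsCoprime t (d : ℤ) := Int.isCoprime_iff_gcd_eq_one.2 ((gcd_eq_gcd_of_modEq htr).trans hr)
    have hte : IsCoprime t (e : ℤ) := Int.isCoprime_iff_gcd_eq_one.2 ((gcd_eq_gcd_of_modEq hts).trans hs)
    have ht : Int.gcd t (Nat.lcm d e : ℕ) = 1 := by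
      refine Int.isCoprime_iff_gcd_eq_one.1 ((htd.mul_right hte).of_isCoprime_of_dvd_right ?_)
      exact_mod_cast Nat.lcm_dvd_mul d e
    have hcount := card_coprime_modEq_mul_totient hn (Nat.lcm_dvd hd he) ht
    have hiff (a : ℕ) : (a : ℤ) ≡ t [ZMOD (Nat.lcm d e : ℕ)] ↔
        (a : ℤ) ≡ r [ZMOD (d : ℤ)] ∧ (a : ℤ) ≡ s [ZMOD (e : ℤ)] := by
      have hsplit : (a : ℤ) ≡ t [ZMOD (Nat.lcm d e : ℕ)] ↔
          (a : ℤ) ≡ t [ZMOD (d : ℤ)] ∧ (a : ℤ) ≡ t [ZMOD (e : ℤ)] := by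
        simp only [Int.modEq_iff_dvd, Int.natCast_dvd, Nat.lcm_dvd_iff]
      rw [hsplit]
      exact and_congr ⟨fun h => h.trans htr, fun h => h.trans htr.symm⟩
        ⟨fun h => h.trans hts, fun h => h.trans hts.symm⟩
    simp only [hiff] at hcount
    have hpos : (0 : ℝ) < Nat.totient (d * e) := by
      exact_mod_cast Nat.totient_pos.2 (Nat.mul_pos hd0 he0)
    rw [eq_div_iff hpos.ne', ← hcount, totient_mul_eq_gcd_mul_totient_lcm hd0]
    push_cast
    ring
  · rw [Nat.cast_eq_zero, Finset.card_eq_zero, Finset.filter_eq_empty_iff]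
    rintro a - ⟨ha, har, has⟩
    refine h ⟨gcd_eq_one_of_modEq hd ha har, gcd_eq_one_of_modEq he ha has, ?_⟩
    have hg₁ := har.of_dvd (Int.natCast_dvd_natCast.2 (Nat.gcd_dvd_left d e))
    have hg₂ := has.of_dvd (Int.natCast_dvd_natCast.2 (Nat.gcd_dvd_right d e))
    exact (hg₂.symm.trans hg₁).dvd
end

section
/- Let k ≥ 2 be an integer and p a prime. Then -(k+1)·p^{k-1} < g_k(p) < 0, where g_k(p) = φ_k(p) - p^k = (1 - 1/p)·((p-1)^k - (-1)^k) - p^k. -/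
open Finset in
/-- A tuple of units of a finite field with sum zero is determined by its tail, which is an arbitrary
tuple of units with nonzero sum. -/
theorem card_units_sum_ne_zero_succ_add (F : Type*) [Field F] [Fintype F] [DecidableEq F] (k : ℕ) :
    #{v : Fin (k + 1) → Fˣ | ∑ i, (v i : F) ≠ 0} + #{v : Fin k → Fˣ | ∑ i, (v i : F) ≠ 0} =
      (Fintype.card F - 1) ^ (k + 1) := by
  have hbij : #{v : Fin k → Fˣ | ∑ i, (v i : F) ≠ 0} =
      #{v : Fin (k + 1) → Fˣ | ¬ ∑ i, (v i : F) ≠ 0} := by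
    refine card_bij
      (fun v hv => Fin.cons (Units.mk0 (-∑ i, (v i : F)) (neg_ne_zero.2 (mem_filter.1 hv).2)) v)
      ?_ ?_ ?_
    · intro v hv
      simp [Fin.sum_univ_succ]
    · intro v hv w hw h
      exact (Fin.cons_injective2 h).2
    · intro w hw
      have hw' : (w 0 : F) + ∑ i : Fin k, (w i.succ : F) = 0 := by
        simpa [Fin.sum_univ_succ] using hw
      have h0 : -∑ i : Fin k, (w i.succ : F) = w 0 := (eq_neg_of_add_eq_zero_left hw').symm
      refine ⟨Fin.tail w, ?_, ?_⟩
      · simp only [mem_filter, mem_univ, true_and, Fin.tail]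
        intro h
        rw [h, neg_zero] at h0
        exact (w 0).ne_zero h0.symm
      · refine (congrArg (fun u => Fin.cons u (Fin.tail w)) ?_).trans (Fin.cons_self_tail w)
        exact Units.ext h0
  rw [hbij, card_filter_add_card_filter_not, card_univ, Fintype.card_fun, Fintype.card_units,
    Fintype.card_fin]

theorem card_mul_card_units_sum_ne_zero (F : Type*) [Field F] [Fintype F] [DecidableEq F] (k : ℕ) :
    (Fintype.card F : ℝ) *
        (Finset.univ.filter fun v : Fin k → Fˣ => ∑ i, (v i : F) ≠ 0).card =
      ((Fintype.card F : ℝ) - 1) * (((Fintype.card F : ℝ) - 1) ^ k - (-1) ^ k) := by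
  induction k with
  | zero => simp
  | succ k ih =>
    have h := congrArg (Nat.cast : ℕ → ℝ) (card_units_sum_ne_zero_succ_add F k)
    push_cast [Nat.cast_sub (Fintype.card_pos (α := F))] at h
    linear_combination (Fintype.card F : ℝ) * h - ih

theorem phiK_prime_eq_card_units (k p : ℕ) [Fact p.Prime] :
    phiK k p =
      (Finset.univ.filter fun v : Fin k → (ZMod p)ˣ => ∑ i, (v i : ZMod p) ≠ 0).card := by
  have hp : p.Prime := Fact.out
  have hcop (m : ℕ) : Nat.gcd m p = 1 ↔ (m : ZMod p) ≠ 0 := by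
    rw [Ne, ZMod.natCast_eq_zero_iff, ← hp.coprime_iff_not_dvd, Nat.coprime_comm]
  symm
  refine Finset.card_bij (fun v _ i => (v i : ZMod p).val) ?_ ?_ ?_
  · intro v hv
    simp only [Finset.mem_filter, Finset.mem_univ, true_and] at hv
    simp only [Finset.mem_filter, Fintype.mem_piFinset, Finset.mem_Icc, hcop]
    refine ⟨fun i => ⟨?_, (ZMod.val_lt _).le⟩, ?_, ?_⟩
    · exact ZMod.val_pos.2 (v i).ne_zero
    · simp [Finset.prod_ne_zero_iff]
    · simpa using hv
  · intro v _ w _ h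
    funext i
    exact Units.ext (ZMod.val_injective p (congrFun h i))
  · intro a ha
    simp only [Finset.mem_filter, Fintype.mem_piFinset, Finset.mem_Icc, hcop, Nat.cast_prod,
      Nat.cast_sum, Finset.prod_ne_zero_iff, Finset.mem_univ, true_implies] at ha
    obtain ⟨hI, hprod, hsum⟩ := ha
    refine ⟨fun i => Units.mk0 (a i : ZMod p) (hprod i), by simpa using hsum, ?_⟩
    funext i
    refine ZMod.val_cast_of_lt ((hI i).2.lt_of_ne fun h => hprod i ?_)
    rw [h, ZMod.natCast_self]

/-- A sharpening of Bernoulli's inequality `(x + 1) ^ (k + 1) ≤ x ^ (k + 1) + (k + 1) (x + 1) ^ k`. -/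
theorem add_one_pow_succ_add_lt {x : ℝ} (hx : 1 ≤ x) {k : ℕ} (hk : 2 ≤ k) :
    (x + 1) ^ (k + 1) + x < x ^ (k + 1) + (k + 1) * (x + 1) ^ k := by
  induction k, hk using Nat.le_induction with
  | base => norm_num; nlinarith
  | succ k hk ih =>
    have h1 := mul_lt_mul_of_pos_left ih (zero_lt_one.trans_le hx)
    have h2 : 0 < ((k : ℝ) + 1) * (x + 1) ^ k := by positivity
    have h3 : x ≤ x * x := le_mul_of_one_le_left (by linarith) hx
    push_cast
    linear_combination h1 + h2 + h3

theorem gk_prime_bounds (k : ℕ) (hk : 2 ≤ k) (p : ℕ) (hp : p.Prime) :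
    (-((k : ℝ) + 1) * (p : ℝ) ^ (k - 1) < (phiK k p : ℝ) - (p : ℝ) ^ k ∧
        (phiK k p : ℝ) - (p : ℝ) ^ k < 0) ∧
      (phiK k p : ℝ) - (p : ℝ) ^ k =
        (1 - 1 / (p : ℝ)) * (((p : ℝ) - 1) ^ k - (-1 : ℝ) ^ k) - (p : ℝ) ^ k := by
  have : Fact p.Prime := ⟨hp⟩
  have hcard : (p : ℝ) * phiK k p = ((p : ℝ) - 1) * (((p : ℝ) - 1) ^ k - (-1) ^ k) := by
    simpa only [phiK_prime_eq_card_units, ZMod.card] using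
      card_mul_card_units_sum_ne_zero (ZMod p) k
  have hp2 : (2 : ℝ) ≤ p := mod_cast hp.two_le
  have hp0 : (0 : ℝ) < p := by linarith
  have hsign := abs_le.1 (abs_neg_one_pow (α := ℝ) k).le
  refine ⟨⟨?_, ?_⟩, ?_⟩
  · have hlt := add_one_pow_succ_add_lt (x := (p : ℝ) - 1) (by linarith) hk
    rw [sub_add_cancel] at hlt
    have hpow : (p : ℝ) * p ^ (k - 1) = p ^ k := mul_pow_sub_one (by omega) _
    have hle : ((p : ℝ) - 1) * (-1) ^ k ≤ (p : ℝ) - 1 :=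
      mul_le_of_le_one_right (by linarith) hsign.2
    refine lt_of_mul_lt_mul_left ?_ hp0.le
    linear_combination hlt + hle - hcard - ((k : ℝ) + 1) * hpow
  · have hbin : ((p : ℝ) - 1) ^ k + 1 ^ k ≤ (p - 1 + 1) ^ k :=
      pow_add_pow_le (by linarith) zero_le_one (by omega)
    rw [one_pow, sub_add_cancel] at hbin
    have hle : ((p : ℝ) - 1) * (((p : ℝ) - 1) ^ k - (-1) ^ k) ≤ (p - 1) * p ^ k :=
      mul_le_mul_of_nonneg_left (by linarith) (by linarith)
    have hpos : 0 < (p : ℝ) ^ k := by positivity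
    refine lt_of_mul_lt_mul_left ?_ hp0.le
    linear_combination hle + hpos + hcard
  · field_simp
    linear_combination hcard
end
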